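/- arXiv:2602.05779 — 5 statements merged into one kernel-verified Lean document; each statement's English description precedes it below -/
import Mathlib

section
/- Let c, b, d be real numbers with 0 < c < 1, and let (r(ℓ))_{ℓ≥1} and (q̃(ℓ))_{ℓ≥1} be real sequences with r(1) = 0 and q̃(1) = 0, satisfying r(ℓ+1) = c²·r(ℓ) + b and q̃(ℓ+1) = c·q̃(ℓ) + (d/2)·r(ℓ) for all ℓ ≥ 1. Then for every ℓ ≥ 3, |q̃(ℓ)| ≤ (1/2)·|d|·|b| / ((1 − c)²·(1 + c)). -/
/-- A solution of the affine recursion `x (n + 1) = a * x n + e n` started at `0` stays in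
`[-M, M]` as soon as the forcing term is at most `(1 - a) * M` in absolute value. -/
theorem abs_le_of_affine_recursion {a M : ℝ} (ha : 0 ≤ a) (hM : 0 ≤ M) {x e : ℕ → ℝ}
    (hx1 : x 1 = 0) (hrec : ∀ n, 1 ≤ n → x (n + 1) = a * x n + e n)
    (he : ∀ n, 1 ≤ n → |e n| ≤ (1 - a) * M) (n : ℕ) (hn : 1 ≤ n) : |x n| ≤ M := by
  induction n, hn using Nat.le_induction with
  | base => simpa [hx1] using hM
  | succ n hn ih =>
    rw [hrec n hn]
    calc |a * x n + e n| ≤ |a * x n| + |e n| := abs_add_le _ _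
      _ = a * |x n| + |e n| := by rw [abs_mul, abs_of_nonneg ha]
      _ ≤ a * M + (1 - a) * M := by gcongr; exact he n hn
      _ = M := by ring

theorem nlo_upper_bound
    (c b d : ℝ) (hc0 : 0 < c) (hc1 : c < 1)
    (r qt : ℕ → ℝ) (hr1 : r 1 = 0) (hq1 : qt 1 = 0)
    (hrecr : ∀ ℓ, 1 ≤ ℓ → r (ℓ + 1) = c ^ 2 * r ℓ + b)
    (hrecq : ∀ ℓ, 1 ≤ ℓ → qt (ℓ + 1) = c * qt ℓ + d / 2 * r ℓ) :
    ∀ ℓ, 3 ≤ ℓ →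
      |qt ℓ| ≤ 1 / 2 * |d| * |b| / ((1 - c) ^ 2 * (1 + c)) := by
  intro ℓ hℓ
  have h1 : 0 < 1 - c := sub_pos.mpr hc1
  have h2 : 0 < 1 + c := by linarith
  have hr : ∀ n, 1 ≤ n → |r n| ≤ |b| / ((1 - c) * (1 + c)) := by
    refine abs_le_of_affine_recursion (sq_nonneg c) (by positivity) hr1 hrecr fun n _ ↦ ?_
    apply le_of_eq
    field_simp
    ring
  refine abs_le_of_affine_recursion hc0.le (by positivity) hq1 hrecq (fun n hn ↦ ?_) ℓ (by omega)
  calc |d / 2 * r n| = |d| / 2 * |r n| := by rw [abs_mul, abs_div, abs_two]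
    _ ≤ |d| / 2 * (|b| / ((1 - c) * (1 + c))) := by gcongr; exact hr n hn
    _ = (1 - c) * (1 / 2 * |d| * |b| / ((1 - c) ^ 2 * (1 + c))) := by field_simp
end

section
/- Let τ ≥ 0, m > 0, σ_w ∈ ℝ and q > 0. Then σ_w² · ∫_ℝ 1_{(τ, τ+m)}(√q·z) dγ(z) = (σ_w²/2)·(erf((τ+m)/√(2q)) − erf(τ/√(2q))), where 1_{(τ,τ+m)} is the indicator function of the open interval (τ, τ+m). Equivalently, χ_{1,CReLU_{τ,m}}(q) = (σ_w²/2)·(erf((τ+m)/√(2q)) − erf(τ/√(2q))). -/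
open MeasureTheory ProbabilityTheory

/-- The standard Gaussian probability measure on ℝ. -/
noncomputable def stdGaussian : Measure ℝ := gaussianReal 0 1

/-- The error function `erf x = (2/√π) ∫₀ˣ e^{-t²} dt`. -/
noncomputable def erf (x : ℝ) : ℝ :=
  (2 / Real.sqrt Real.pi) * ∫ t in (0:ℝ)..x, Real.exp (-t ^ 2)

theorem erf_sub_erf (x y : ℝ) :
    erf y - erf x = 2 / √Real.pi * ∫ t in x..y, Real.exp (-t ^ 2) := by
  have hint (a b : ℝ) : IntervalIntegrable (fun t : ℝ ↦ Real.exp (-t ^ 2)) volume a b :=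
    Continuous.intervalIntegrable (by fun_prop) a b
  rw [erf, erf, ← mul_sub, intervalIntegral.integral_interval_sub_left (hint 0 y) (hint 0 x)]

theorem stdGaussian_real_Ioo {a b : ℝ} (hab : a ≤ b) :
    stdGaussian.real (Set.Ioo a b) = (erf (b / √2) - erf (a / √2)) / 2 := by
  have hpdf (z : ℝ) :
      gaussianPDFReal 0 1 z = (√(2 * Real.pi))⁻¹ * Real.exp (-(z / √2) ^ 2) := by
    simp [gaussianPDFReal, div_pow, neg_div]
  have hnonneg : 0 ≤ ∫ z in Set.Ioo a b, gaussianPDFReal 0 1 z :=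
    integral_nonneg fun z ↦ gaussianPDFReal_nonneg 0 1 z
  rw [measureReal_def, _root_.stdGaussian, gaussianReal_apply_eq_integral 0 one_ne_zero,
    ENNReal.toReal_ofReal hnonneg, ← integral_Ioc_eq_integral_Ioo,
    ← intervalIntegral.integral_of_le hab]
  simp_rw [hpdf]
  rw [intervalIntegral.integral_const_mul,
    intervalIntegral.integral_comp_div (fun t ↦ Real.exp (-t ^ 2)) (by positivity),
    erf_sub_erf, smul_eq_mul, Real.sqrt_mul zero_le_two]
  field_simp

theorem chi1_CReLU_closed_form
    (τ m σw q : ℝ) (hτ : 0 ≤ τ) (hm : 0 < m) (hq : 0 < q) :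
    σw ^ 2 * ∫ z, (Set.Ioo τ (τ + m)).indicator (fun _ => (1:ℝ)) (Real.sqrt q * z)
        ∂stdGaussian
      = σw ^ 2 / 2 *
        (erf ((τ + m) / Real.sqrt (2 * q)) - erf (τ / Real.sqrt (2 * q))) := by
  have hs : 0 < √q := Real.sqrt_pos.2 hq
  have hpre : (fun z ↦ √q * z) ⁻¹' Set.Ioo τ (τ + m) = Set.Ioo (τ / √q) ((τ + m) / √q) :=
    Set.preimage_const_mul_Ioo₀ τ (τ + m) hs
  have hind (z : ℝ) : (Set.Ioo τ (τ + m)).indicator (fun _ ↦ (1 : ℝ)) (√q * z) =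
      (Set.Ioo (τ / √q) ((τ + m) / √q)).indicator 1 z := by
    rw [← hpre]
    rfl
  simp_rw [hind]
  rw [integral_indicator_one measurableSet_Ioo,
    stdGaussian_real_Ioo (div_le_div_of_nonneg_right (by linarith) hs.le),
    div_div, div_div, ← Real.sqrt_mul hq.le, mul_comm q 2]
  ring
end

section
/- Let τ ≥ 0, m > 0 and σ_w, σ_b ∈ ℝ, and define V(q) = σ_w² · ∫_ℝ (CReLU_{τ,m}(√q·z))² dγ(z) + σ_b² for q > 0. Then V is differentiable on (0, ∞) and for every q > 0, V'(q) = σ_w² · ( (1/2)·erf((τ+m)/√(2q)) − (1/2)·erf(τ/√(2q)) − (m/√(2πq))·exp(−(τ+m)²/(2q)) ). -/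
open MeasureTheory ProbabilityTheory

/-- The clipped and shifted ReLU activation. -/
noncomputable def CReLU (τ m x : ℝ) : ℝ :=
  if x < τ then 0 else if x ≤ τ + m then x - τ else m

lemma CReLU_eq_max_min {m : ℝ} (hm : 0 ≤ m) (τ x : ℝ) :
    CReLU τ m x = max 0 (min (x - τ) m) := by
  unfold CReLU
  split_ifs with h₁ h₂
  · rw [min_eq_left (by linarith), max_eq_left (by linarith)]
  · rw [min_eq_left (by linarith), max_eq_right (by linarith)]
  · rw [min_eq_right (by linarith), max_eq_right hm]

lemma CReLU_nonneg {m : ℝ} (hm : 0 ≤ m) (τ x : ℝ) : 0 ≤ CReLU τ m x := by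
  rw [CReLU_eq_max_min hm]
  exact le_max_left _ _

lemma CReLU_le {m : ℝ} (hm : 0 ≤ m) (τ x : ℝ) : CReLU τ m x ≤ m := by
  rw [CReLU_eq_max_min hm]
  exact max_le hm (min_le_right _ _)

lemma continuous_CReLU {m : ℝ} (hm : 0 ≤ m) (τ : ℝ) : Continuous (CReLU τ m) := by
  rw [funext (CReLU_eq_max_min hm τ)]
  fun_prop

lemma abs_CReLU_sub_le {m : ℝ} (hm : 0 ≤ m) (τ x y : ℝ) :
    |CReLU τ m x - CReLU τ m y| ≤ |x - y| := by
  rw [CReLU_eq_max_min hm, CReLU_eq_max_min hm]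
  calc |max 0 (min (x - τ) m) - max 0 (min (y - τ) m)|
      ≤ |min (x - τ) m - min (y - τ) m| := by
        simpa using abs_max_sub_max_le_max 0 (min (x - τ) m) 0 (min (y - τ) m)
    _ ≤ |x - y| := by
        simpa using abs_min_sub_min_le_max (x - τ) m (y - τ) m

lemma abs_CReLU_sq_sub_le {m : ℝ} (hm : 0 ≤ m) (τ x y : ℝ) :
    |CReLU τ m x ^ 2 - CReLU τ m y ^ 2| ≤ 2 * m * |x - y| := by
  have hx := CReLU_nonneg hm τ x
  have hy := CReLU_nonneg hm τ y
  rw [sq_sub_sq, abs_mul, abs_of_nonneg (add_nonneg hx hy)]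
  refine mul_le_mul ?_ (abs_CReLU_sub_le hm τ x y) (abs_nonneg _) (by positivity)
  linarith [CReLU_le hm τ x, CReLU_le hm τ y]

lemma hasDerivAt_CReLU_sq {τ m x : ℝ} (hm : 0 ≤ m) (h₁ : x ≠ τ) (h₂ : x ≠ τ + m) :
    HasDerivAt (fun y => CReLU τ m y ^ 2)
      ((Set.Ioc τ (τ + m)).indicator (fun y => 2 * (y - τ)) x) x := by
  rcases lt_or_gt_of_ne h₁ with h | h
  · rw [Set.indicator_of_notMem (fun hx => absurd hx.1 h.not_gt)]
    refine (hasDerivAt_const x (0 : ℝ)).congr_of_eventuallyEq ?_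
    filter_upwards [Iio_mem_nhds h] with y hy
    simp [CReLU, Set.mem_Iio.1 hy]
  rcases lt_or_gt_of_ne h₂ with h' | h'
  · rw [Set.indicator_of_mem (Set.mem_Ioc.2 ⟨h, h'.le⟩)]
    have hd : HasDerivAt (fun y : ℝ => (y - τ) ^ 2) (2 * (x - τ)) x :=
      (((hasDerivAt_id x).sub_const τ).pow 2).congr_deriv (by simp)
    refine hd.congr_of_eventuallyEq ?_
    filter_upwards [Ioo_mem_nhds h h'] with y hy
    simp [CReLU, hy.1.not_gt, hy.2.le]
  · rw [Set.indicator_of_notMem (fun hx => absurd hx.2 h'.not_ge)]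
    refine (hasDerivAt_const x (m ^ 2)).congr_of_eventuallyEq ?_
    filter_upwards [Ioi_mem_nhds h'] with y hy
    have hy' : τ + m < y := hy
    simp [CReLU, hy'.not_ge, (show ¬ y < τ by linarith)]

lemma hasDerivAt_erf (x : ℝ) :
    HasDerivAt erf (2 / Real.sqrt Real.pi * Real.exp (-x ^ 2)) x := by
  have hc : Continuous fun t : ℝ => Real.exp (-t ^ 2) := by fun_prop
  exact (hc.integral_hasStrictDerivAt 0 x).hasDerivAt.const_mul _

lemma gaussianPDFReal_zero_one (x : ℝ) :
    gaussianPDFReal 0 1 x = (Real.sqrt (2 * Real.pi))⁻¹ * Real.exp (-x ^ 2 / 2) := by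
  simp [gaussianPDFReal]

/-- The standard Gaussian distribution function is `1 / 2 + erf (x / √2) / 2`. -/
lemma hasDerivAt_half_erf_div_sqrt_two (x : ℝ) :
    HasDerivAt (fun y => 1 / 2 * erf (y / Real.sqrt 2)) (gaussianPDFReal 0 1 x) x := by
  have h := ((hasDerivAt_erf (x / Real.sqrt 2)).comp x
    ((hasDerivAt_id x).div_const (Real.sqrt 2))).const_mul (1 / 2)
  refine h.congr_deriv ?_
  rw [gaussianPDFReal_zero_one, Real.sqrt_mul (by norm_num), div_pow, Real.sq_sqrt (by norm_num),
    neg_div]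
  field_simp

lemma hasDerivAt_gaussianPDFReal_zero_one (x : ℝ) :
    HasDerivAt (gaussianPDFReal 0 1) (-x * gaussianPDFReal 0 1 x) x := by
  rw [funext gaussianPDFReal_zero_one]
  have h : HasDerivAt (fun y : ℝ => -y ^ 2 / 2) (-x) x :=
    (((hasDerivAt_id x).pow 2).neg.div_const 2).congr_deriv (by simp; ring)
  exact (h.exp.const_mul _).congr_deriv (by ring)

lemma continuous_gaussianPDFReal_zero_one : Continuous (gaussianPDFReal 0 1) :=
  continuous_iff_continuousAt.2 fun x => (hasDerivAt_gaussianPDFReal_zero_one x).continuousAt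

lemma intervalIntegral_affine_mul_id_mul_gaussianPDFReal (s τ a b : ℝ) :
    ∫ z in a..b, (s * z - τ) * z * gaussianPDFReal 0 1 z =
      s * (1 / 2 * erf (b / Real.sqrt 2) - 1 / 2 * erf (a / Real.sqrt 2))
        - (s * b - τ) * gaussianPDFReal 0 1 b + (s * a - τ) * gaussianPDFReal 0 1 a := by
  have hd : ∀ z : ℝ, HasDerivAt
      (fun z => s * (1 / 2 * erf (z / Real.sqrt 2)) - (s * z - τ) * gaussianPDFReal 0 1 z)
      ((s * z - τ) * z * gaussianPDFReal 0 1 z) z := fun z =>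
    (((hasDerivAt_half_erf_div_sqrt_two z).const_mul s).sub
      ((((hasDerivAt_id z).const_mul s).sub_const τ).mul
        (hasDerivAt_gaussianPDFReal_zero_one z))).congr_deriv (by simp; ring)
  have hc := continuous_gaussianPDFReal_zero_one
  rw [intervalIntegral.integral_eq_sub_of_hasDerivAt (fun z _ => hd z)
    (Continuous.intervalIntegrable (by fun_prop) _ _)]
  ring

lemma hasDerivAt_integral_CReLU_sq {τ m s : ℝ} (hm : 0 ≤ m) (hs : 0 < s) :
    HasDerivAt (fun t => ∫ z, CReLU τ m (t * z) ^ 2 ∂stdGaussian)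
      (2 * (s * (1 / 2 * erf ((τ + m) / s / Real.sqrt 2) - 1 / 2 * erf (τ / s / Real.sqrt 2))
        - m * gaussianPDFReal 0 1 ((τ + m) / s))) s := by
  have hprob : IsProbabilityMeasure _root_.stdGaussian := by unfold _root_.stdGaussian; infer_instance
  have hatoms : NullSingletonClass _root_.stdGaussian := by
    unfold _root_.stdGaussian; exact nullSingletonClass_gaussianReal one_ne_zero
  have hcont : ∀ t, Continuous fun z => CReLU τ m (t * z) ^ 2 := fun t =>
    ((continuous_CReLU hm τ).comp (continuous_const_mul t)).pow 2
  have hind : Measurable ((Set.Ioc τ (τ + m)).indicator (fun y : ℝ => 2 * (y - τ))) :=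
    Measurable.indicator (by fun_prop) measurableSet_Ioc
  have hmeas : Measurable fun z =>
      (Set.Ioc τ (τ + m)).indicator (fun y => 2 * (y - τ)) (s * z) * z :=
    (hind.comp (measurable_const_mul s)).mul measurable_id
  have hint : Integrable (fun z => CReLU τ m (s * z) ^ 2) stdGaussian := by
    refine Integrable.of_bound (hcont s).aestronglyMeasurable (m ^ 2) (.of_forall fun z => ?_)
    rw [Real.norm_of_nonneg (sq_nonneg _)]
    exact pow_le_pow_left₀ (CReLU_nonneg hm _ _) (CReLU_le hm _ _) 2
  have hid : Integrable (fun z : ℝ => z) stdGaussian :=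
    (memLp_id_gaussianReal (μ := 0) (v := 1) 1).integrable le_rfl
  have hlip : ∀ᵐ z ∂_root_.stdGaussian, LipschitzOnWith (Real.nnabs (2 * m * z))
      (fun t => CReLU τ m (t * z) ^ 2) Set.univ := by
    refine .of_forall fun z => LipschitzOnWith.of_dist_le_mul fun t _ u _ => ?_
    rw [Real.dist_eq, Real.dist_eq, Real.coe_nnabs]
    refine (abs_CReLU_sq_sub_le hm τ _ _).trans_eq ?_
    rw [← sub_mul, abs_mul, abs_mul (2 * m), abs_of_nonneg (show 0 ≤ 2 * m by positivity)]
    ring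
  have hderiv : ∀ᵐ z ∂_root_.stdGaussian, HasDerivAt (fun t => CReLU τ m (t * z) ^ 2)
      ((Set.Ioc τ (τ + m)).indicator (fun y => 2 * (y - τ)) (s * z) * z) s := by
    filter_upwards [Measure.ae_ne _root_.stdGaussian (τ / s),
      Measure.ae_ne _root_.stdGaussian ((τ + m) / s)]
      with z h₁ h₂
    rw [ne_eq, eq_div_iff hs.ne', mul_comm] at h₁ h₂
    exact (hasDerivAt_CReLU_sq hm h₁ h₂).comp s (by simpa using (hasDerivAt_id s).mul_const z)
  refine (hasDerivAt_integral_of_dominated_loc_of_lip Filter.univ_mem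
    (.of_forall fun t => (hcont t).aestronglyMeasurable) hint
    hmeas.aestronglyMeasurable hlip
    (hid.const_mul (2 * m)) hderiv).2.congr_deriv ?_
  have hle : τ / s ≤ (τ + m) / s := by gcongr; linarith
  have hset : ∀ z, gaussianPDFReal 0 1 z •
      ((Set.Ioc τ (τ + m)).indicator (fun y => 2 * (y - τ)) (s * z) * z) =
      (Set.Ioc (τ / s) ((τ + m) / s)).indicator
        (fun z => 2 * ((s * z - τ) * z * gaussianPDFReal 0 1 z)) z := fun z => by
    have hmem : s * z ∈ Set.Ioc τ (τ + m) ↔ z ∈ Set.Ioc (τ / s) ((τ + m) / s) := by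
      rw [Set.mem_Ioc, Set.mem_Ioc, div_lt_iff₀' hs, le_div_iff₀' hs]
    by_cases hz : z ∈ Set.Ioc (τ / s) ((τ + m) / s)
    · rw [Set.indicator_of_mem hz, Set.indicator_of_mem (hmem.2 hz), smul_eq_mul]
      ring
    · rw [Set.indicator_of_notMem hz, Set.indicator_of_notMem (mt hmem.1 hz), zero_mul, smul_zero]
  rw [_root_.stdGaussian, integral_gaussianReal_eq_integral_smul one_ne_zero]
  simp_rw [hset]
  rw [integral_indicator measurableSet_Ioc, ← intervalIntegral.integral_of_le hle,
    intervalIntegral.integral_const_mul, intervalIntegral_affine_mul_id_mul_gaussianPDFReal,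
    mul_div_cancel₀ _ hs.ne', mul_div_cancel₀ _ hs.ne']
  ring

theorem vmap_CReLU_deriv
    (τ m σw σb : ℝ) (hτ : 0 ≤ τ) (hm : 0 < m) :
    ∀ q ∈ Set.Ioi (0:ℝ),
      HasDerivAt
        (fun q : ℝ =>
          σw ^ 2 * ∫ z, (CReLU τ m (Real.sqrt q * z)) ^ 2 ∂stdGaussian + σb ^ 2)
        (σw ^ 2 *
          (1 / 2 * erf ((τ + m) / Real.sqrt (2 * q))
            - 1 / 2 * erf (τ / Real.sqrt (2 * q))
            - m / Real.sqrt (2 * Real.pi * q) * Real.exp (-(τ + m) ^ 2 / (2 * q))))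
        q := by
  intro q hq
  have hq : 0 < q := hq
  have hs : 0 < Real.sqrt q := Real.sqrt_pos.2 hq
  have hF := (hasDerivAt_integral_CReLU_sq (τ := τ) hm.le hs).comp q (Real.hasDerivAt_sqrt hq.ne')
  refine ((hF.const_mul (σw ^ 2)).add_const (σb ^ 2)).congr_deriv ?_
  have hsqrt : Real.sqrt (2 * q) = Real.sqrt q * Real.sqrt 2 := by
    rw [mul_comm, Real.sqrt_mul hq.le]
  have hexp : -((τ + m) / Real.sqrt q) ^ 2 / 2 = -(τ + m) ^ 2 / (2 * q) := by
    rw [div_pow, Real.sq_sqrt hq.le]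
    field_simp
  rw [gaussianPDFReal_zero_one, hexp, div_div, div_div, hsqrt,
    Real.sqrt_mul (show 0 ≤ 2 * Real.pi by positivity) q]
  have hpi : 0 < Real.sqrt (2 * Real.pi) := by positivity
  field_simp
end

section
/- Let τ ≥ 0, m > 0 and σ_w, σ_b ∈ ℝ, and define V(q) = σ_w² · ∫_ℝ (CReLU_{τ,m}(√q·z))² dγ(z) + σ_b² for q > 0. Then V is twice differentiable on (0, ∞) and for every q > 0, V''(q) = (σ_w²/√(8πq³)) · ( τ·exp(−τ²/(2q)) − (τ+m)·exp(−(τ+m)²/(2q)) + m·(1 − (τ+m)²/q)·exp(−(τ+m)²/(2q)) ). -/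
open MeasureTheory ProbabilityTheory

/-- The standard Gaussian density. -/
noncomputable def gaussDensity (z : ℝ) : ℝ := (Real.sqrt (2 * Real.pi))⁻¹ * Real.exp (-z ^ 2 / 2)

lemma gaussDensity_eq_gaussianPDFReal : gaussDensity = gaussianPDFReal 0 1 := by
  ext z
  simp [gaussDensity, gaussianPDFReal]

lemma continuous_gaussDensity : Continuous gaussDensity := by
  unfold gaussDensity
  fun_prop

lemma integrable_gaussDensity : Integrable gaussDensity := by
  rw [gaussDensity_eq_gaussianPDFReal]
  exact integrable_gaussianPDFReal 0 1

lemma hasDerivAt_gaussDensity (z : ℝ) : HasDerivAt gaussDensity (-z * gaussDensity z) z := by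
  have h1 : HasDerivAt (fun z : ℝ => -z ^ 2 / 2) (-z) z := by
    refine ((hasDerivAt_pow 2 z).neg.div_const 2).congr_deriv ?_
    norm_num
    ring
  refine (h1.exp.const_mul (Real.sqrt (2 * Real.pi))⁻¹).congr_deriv ?_
  unfold gaussDensity
  ring

/-- The Gaussian mass of the interval from `0` to `x`. -/
noncomputable def gaussPrimitive (x : ℝ) : ℝ := ∫ z in (0:ℝ)..x, gaussDensity z

lemma hasDerivAt_gaussPrimitive (x : ℝ) : HasDerivAt gaussPrimitive (gaussDensity x) x :=
  continuous_gaussDensity.integral_hasStrictDerivAt 0 x |>.hasDerivAt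

lemma integral_stdGaussian (f : ℝ → ℝ) : ∫ z, f z ∂stdGaussian = ∫ z, gaussDensity z * f z := by
  rw [_root_.stdGaussian, integral_gaussianReal_eq_integral_smul one_ne_zero,
    gaussDensity_eq_gaussianPDFReal]
  simp

lemma integral_sq_affine_mul_gaussDensity (s τ a b : ℝ) :
    ∫ z in a..b, gaussDensity z * (s * z - τ) ^ 2 =
      s ^ 2 * (a * gaussDensity a - b * gaussDensity b + gaussPrimitive b - gaussPrimitive a)
        - 2 * τ * s * (gaussDensity a - gaussDensity b)
        + τ ^ 2 * (gaussPrimitive b - gaussPrimitive a) := by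
  have key : ∀ x, HasDerivAt
      (fun z => s ^ 2 * (gaussPrimitive z - z * gaussDensity z) + 2 * τ * s * gaussDensity z
        + τ ^ 2 * gaussPrimitive z) (gaussDensity x * (s * x - τ) ^ 2) x := by
    intro x
    have hG := hasDerivAt_gaussPrimitive x
    have hD := hasDerivAt_gaussDensity x
    refine ((((hG.sub ((hasDerivAt_id x).mul hD)).const_mul (s ^ 2)).add
      (hD.const_mul (2 * τ * s))).add (hG.const_mul (τ ^ 2))).congr_deriv ?_
    simp only [id]
    ring
  rw [intervalIntegral.integral_eq_sub_of_hasDerivAt (fun x _ => key x)]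
  · ring
  · refine Continuous.intervalIntegrable ?_ _ _
    have := continuous_gaussDensity
    fun_prop

lemma setIntegral_Ioi_gaussDensity (b : ℝ) :
    ∫ z in Set.Ioi b, gaussDensity z = (∫ z in Set.Ioi 0, gaussDensity z) - gaussPrimitive b := by
  have h := intervalIntegral.integral_interval_add_Ioi (a := 0) (b := b)
    integrable_gaussDensity.integrableOn integrable_gaussDensity.integrableOn
  unfold gaussPrimitive
  linarith

/-- The Gaussian second moment of the activation at standard deviation `s`. -/
noncomputable def creluMoment (τ m s : ℝ) : ℝ :=
  s ^ 2 * (τ / s * gaussDensity (τ / s) - (τ + m) / s * gaussDensity ((τ + m) / s)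
      + gaussPrimitive ((τ + m) / s) - gaussPrimitive (τ / s))
    - 2 * τ * s * (gaussDensity (τ / s) - gaussDensity ((τ + m) / s))
    + τ ^ 2 * (gaussPrimitive ((τ + m) / s) - gaussPrimitive (τ / s))
    + m ^ 2 * ((∫ z in Set.Ioi 0, gaussDensity z) - gaussPrimitive ((τ + m) / s))

lemma integral_CReLU_sq (τ m s : ℝ) (hm : 0 < m) (hs : 0 < s) :
    ∫ z, (CReLU τ m (s * z)) ^ 2 ∂stdGaussian = creluMoment τ m s := by
  have hab : τ / s ≤ (τ + m) / s := by gcongr; linarith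
  have hsplit : (fun z => gaussDensity z * (CReLU τ m (s * z)) ^ 2) = fun z =>
      (Set.Ioc (τ / s) ((τ + m) / s)).indicator (fun z => gaussDensity z * (s * z - τ) ^ 2) z
        + (Set.Ioi ((τ + m) / s)).indicator (fun z => m ^ 2 * gaussDensity z) z := by
    ext z
    simp only [CReLU, Set.indicator, Set.mem_Ioc, Set.mem_Ioi, div_lt_iff₀' hs, le_div_iff₀' hs]
    rcases lt_trichotomy (s * z) τ with h | h | h
    · simp [h, h.not_gt, (by linarith : ¬ τ + m < s * z)]
    · simp [h, hm.le]
    · by_cases h' : s * z ≤ τ + m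
      · simp [h, h.not_gt, h', h'.not_gt]
      · simp [h.not_gt, h', not_le.mp h', mul_comm]
  have hcont : Continuous fun z => gaussDensity z * (s * z - τ) ^ 2 := by
    have := continuous_gaussDensity
    fun_prop
  rw [integral_stdGaussian, hsplit, integral_add
    ((integrable_indicator_iff measurableSet_Ioc).2 hcont.integrableOn_Ioc)
    ((integrable_gaussDensity.const_mul _).indicator measurableSet_Ioi),
    integral_indicator measurableSet_Ioc, integral_indicator measurableSet_Ioi,
    ← intervalIntegral.integral_of_le hab, integral_sq_affine_mul_gaussDensity,
    integral_const_mul, setIntegral_Ioi_gaussDensity]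
  rfl

/-- The derivative of the Gaussian second moment of the activation with respect to the variance,
as a function of the standard deviation. -/
noncomputable def creluMomentSlope (τ m s : ℝ) : ℝ :=
  gaussPrimitive ((τ + m) / s) - gaussPrimitive (τ / s) - m * (gaussDensity ((τ + m) / s) / s)

lemma hasDerivAt_const_div (c : ℝ) {s : ℝ} (hs : s ≠ 0) :
    HasDerivAt (fun s : ℝ => c / s) (-(c / s ^ 2)) s := by
  refine ((hasDerivAt_const s c).div (hasDerivAt_id s) hs).congr_deriv ?_
  simp
  ring

lemma hasDerivAt_gaussPrimitive_const_div (c : ℝ) {s : ℝ} (hs : s ≠ 0) :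
    HasDerivAt (fun s : ℝ => gaussPrimitive (c / s)) (gaussDensity (c / s) * -(c / s ^ 2)) s :=
  (hasDerivAt_gaussPrimitive (c / s)).comp s (hasDerivAt_const_div c hs)

lemma hasDerivAt_gaussDensity_const_div (c : ℝ) {s : ℝ} (hs : s ≠ 0) :
    HasDerivAt (fun s : ℝ => gaussDensity (c / s))
      (-(c / s) * gaussDensity (c / s) * -(c / s ^ 2)) s :=
  (hasDerivAt_gaussDensity (c / s)).comp s (hasDerivAt_const_div c hs)

lemma hasDerivAt_creluMoment (τ m : ℝ) {s : ℝ} (hs : s ≠ 0) :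
    HasDerivAt (creluMoment τ m) (2 * s * creluMomentSlope τ m s) s := by
  have hGa := hasDerivAt_gaussPrimitive_const_div τ hs
  have hGb := hasDerivAt_gaussPrimitive_const_div (τ + m) hs
  have hDa := hasDerivAt_gaussDensity_const_div τ hs
  have hDb := hasDerivAt_gaussDensity_const_div (τ + m) hs
  have ha := hasDerivAt_const_div τ hs
  have hb := hasDerivAt_const_div (τ + m) hs
  refine (((((hasDerivAt_pow 2 s).mul ((((ha.mul hDa).sub (hb.mul hDb)).add hGb).sub hGa)).sub
    (((hasDerivAt_id s).const_mul (2 * τ)).mul (hDa.sub hDb))).add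
    ((hGb.sub hGa).const_mul (τ ^ 2))).add
    ((hGb.const_sub (∫ z in Set.Ioi 0, gaussDensity z)).const_mul (m ^ 2))).congr_deriv ?_
  simp only [creluMomentSlope, id, Pi.mul_apply, Pi.sub_apply, Pi.add_apply]
  field_simp
  push_cast
  ring

lemma hasDerivAt_creluMomentSlope (τ m : ℝ) {s : ℝ} (hs : s ≠ 0) :
    HasDerivAt (creluMomentSlope τ m)
      ((τ * gaussDensity (τ / s) - (τ + m) * gaussDensity ((τ + m) / s)
        + m * (1 - (τ + m) ^ 2 / s ^ 2) * gaussDensity ((τ + m) / s)) / s ^ 2) s := by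
  have hGa := hasDerivAt_gaussPrimitive_const_div τ hs
  have hGb := hasDerivAt_gaussPrimitive_const_div (τ + m) hs
  have hDb := hasDerivAt_gaussDensity_const_div (τ + m) hs
  refine ((hGb.sub hGa).sub ((hDb.div (hasDerivAt_id s) hs).const_mul m)).congr_deriv ?_
  simp only [id]
  field_simp
  ring

lemma gaussDensity_div_sqrt (c : ℝ) {q : ℝ} (hq : 0 < q) :
    gaussDensity (c / Real.sqrt q) =
      (Real.sqrt (2 * Real.pi))⁻¹ * Real.exp (-c ^ 2 / (2 * q)) := by
  rw [gaussDensity, div_pow, Real.sq_sqrt hq.le]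
  congr 2
  field_simp

lemma sqrt_eight_pi_mul_cube {q : ℝ} (hq : 0 < q) :
    Real.sqrt (8 * Real.pi * q ^ 3) = 2 * q * Real.sqrt q * Real.sqrt (2 * Real.pi) := by
  rw [show 8 * Real.pi * q ^ 3 = (2 * q) ^ 2 * (q * (2 * Real.pi)) by ring,
    Real.sqrt_mul (by positivity), Real.sqrt_sq (by positivity), Real.sqrt_mul hq.le]
  ring

theorem vmap_CReLU_second_deriv
    (τ m σw σb : ℝ) (hτ : 0 ≤ τ) (hm : 0 < m) :
    ∃ V' : ℝ → ℝ,
      (∀ q ∈ Set.Ioi (0:ℝ),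
        HasDerivAt
          (fun q : ℝ =>
            σw ^ 2 * ∫ z, (CReLU τ m (Real.sqrt q * z)) ^ 2 ∂stdGaussian + σb ^ 2)
          (V' q) q) ∧
      (∀ q ∈ Set.Ioi (0:ℝ),
        HasDerivAt V'
          (σw ^ 2 / Real.sqrt (8 * Real.pi * q ^ 3) *
            (τ * Real.exp (-τ ^ 2 / (2 * q))
              - (τ + m) * Real.exp (-(τ + m) ^ 2 / (2 * q))
              + m * (1 - (τ + m) ^ 2 / q) * Real.exp (-(τ + m) ^ 2 / (2 * q))))
          q) := by
  refine ⟨fun q => σw ^ 2 * creluMomentSlope τ m (Real.sqrt q), fun q hq => ?_, fun q hq => ?_⟩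
  · have hq : 0 < q := hq
    have hs : Real.sqrt q ≠ 0 := (Real.sqrt_pos.2 hq).ne'
    have h := ((((hasDerivAt_creluMoment τ m hs).comp q (Real.hasDerivAt_sqrt hq.ne')).const_mul
      (σw ^ 2)).add_const (σb ^ 2))
    refine (h.congr_deriv ?_).congr_of_eventuallyEq ?_
    · field_simp
    · filter_upwards [Ioi_mem_nhds hq] with x hx
      rw [integral_CReLU_sq τ m _ hm (Real.sqrt_pos.2 hx)]
      rfl
  · have hq : 0 < q := hq
    have hs : Real.sqrt q ≠ 0 := (Real.sqrt_pos.2 hq).ne'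
    refine (((hasDerivAt_creluMomentSlope τ m hs).comp q
      (Real.hasDerivAt_sqrt hq.ne')).const_mul (σw ^ 2)).congr_deriv ?_
    rw [gaussDensity_div_sqrt τ hq, gaussDensity_div_sqrt (τ + m) hq, Real.sq_sqrt hq.le,
      sqrt_eight_pi_mul_cube hq]
    have : Real.sqrt (2 * Real.pi) ≠ 0 := by positivity
    generalize Real.sqrt (2 * Real.pi) = r at *
    field_simp
end

section
/- Let τ ≥ 0, m > 0 and q > 0. Then ∫_ℝ (CST_{τ,m}(√q·z))² dγ(z) = 2·∫_ℝ (CReLU_{τ,m}(√q·z))² dγ(z). Consequently, with V_{CST}(q) = σ_w² ∫_ℝ (CST_{τ,m}(√q·z))² dγ(z) + σ_b² and V_{CReLU}(q) = σ_w² ∫_ℝ (CReLU_{τ,m}(√q·z))² dγ(z) + σ_b², one has V_{CST}(q) − σ_b² = 2·(V_{CReLU}(q) − σ_b²) for all q > 0. -/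
open MeasureTheory ProbabilityTheory

/-- The clipped soft-thresholding activation. -/
noncomputable def CST (τ m x : ℝ) : ℝ :=
  if |x| < τ then 0
  else if |x| ≤ τ + m then x - Real.sign x * τ
  else Real.sign x * m

lemma CST_sq_eq_add {τ m : ℝ} (hτ : 0 ≤ τ) (hm : 0 < m) (x : ℝ) :
    CST τ m x ^ 2 = CReLU τ m x ^ 2 + CReLU τ m (-x) ^ 2 := by
  unfold CST CReLU
  rcases lt_trichotomy x 0 with hx | rfl | hx
  · rw [abs_of_neg hx, Real.sign_of_neg hx]
    split_ifs <;> first | (exfalso; linarith) | ring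
  · have h : τ ≤ 0 → τ = 0 := fun h => le_antisymm h hτ
    simp only [abs_zero, Real.sign_zero, neg_zero]
    split_ifs with h₁ h₂
    · ring
    · rw [h (not_lt.mp h₁)]
      ring
    · exact absurd (add_nonneg hτ hm.le) h₂
  · rw [abs_of_pos hx, Real.sign_of_pos hx]
    split_ifs <;> first | (exfalso; linarith) | ring

lemma measurable_CReLU (τ m : ℝ) : Measurable (CReLU τ m) := by
  unfold CReLU
  exact Measurable.ite measurableSet_Iio measurable_const
    (Measurable.ite measurableSet_Iic (measurable_id.sub_const τ) measurable_const)

lemma abs_CReLU_le {m : ℝ} (hm : 0 ≤ m) (τ x : ℝ) : |CReLU τ m x| ≤ m := by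
  unfold CReLU
  split_ifs <;> rw [abs_le] <;> constructor <;> linarith

lemma integrable_CReLU_sq {m : ℝ} (hm : 0 ≤ m) (τ a : ℝ) (μ : Measure ℝ) [IsFiniteMeasure μ] :
    Integrable (fun z => CReLU τ m (a * z) ^ 2) μ := by
  refine Integrable.of_bound (C := m ^ 2)
    (((measurable_CReLU τ m).comp (measurable_const_mul a)).pow_const 2).aestronglyMeasurable
    (.of_forall fun z => ?_)
  rw [Real.norm_eq_abs, abs_pow]
  exact pow_le_pow_left₀ (abs_nonneg _) (abs_CReLU_le hm τ _) 2

lemma integral_comp_neg_stdGaussian (f : ℝ → ℝ) :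
    ∫ z, f (-z) ∂_root_.stdGaussian = ∫ z, f z ∂_root_.stdGaussian := by
  have h : _root_.stdGaussian.map (fun z => -z) = _root_.stdGaussian := by
    simp [_root_.stdGaussian, gaussianReal_map_neg]
  conv_rhs => rw [← h]
  exact ((MeasurableEquiv.neg ℝ).measurableEmbedding.integral_map f).symm

lemma integral_CST_sq {τ m : ℝ} (hτ : 0 ≤ τ) (hm : 0 < m) (a : ℝ) :
    ∫ z, CST τ m (a * z) ^ 2 ∂_root_.stdGaussian =
      2 * ∫ z, CReLU τ m (a * z) ^ 2 ∂_root_.stdGaussian := by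
  have : IsFiniteMeasure _root_.stdGaussian := by
    unfold _root_.stdGaussian
    infer_instance
  have h := integral_comp_neg_stdGaussian (fun z => CReLU τ m (a * z) ^ 2)
  have hneg : Integrable (fun z => CReLU τ m (a * -z) ^ 2) _root_.stdGaussian := by
    simpa only [neg_mul, mul_neg] using integrable_CReLU_sq hm.le τ (-a) _root_.stdGaussian
  simp_rw [CST_sq_eq_add hτ hm, ← mul_neg]
  rw [integral_add (integrable_CReLU_sq hm.le τ a _) hneg, h, two_mul]

theorem cst_vmap_eq_twice_crelu_vmap
    (τ m q : ℝ) (hτ : 0 ≤ τ) (hm : 0 < m) (hq : 0 < q) :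
    (∫ z, (CST τ m (Real.sqrt q * z)) ^ 2 ∂stdGaussian)
      = 2 * ∫ z, (CReLU τ m (Real.sqrt q * z)) ^ 2 ∂stdGaussian ∧
    ∀ σw σb : ℝ,
      (σw ^ 2 * ∫ z, (CST τ m (Real.sqrt q * z)) ^ 2 ∂stdGaussian + σb ^ 2) - σb ^ 2
        = 2 * ((σw ^ 2 * ∫ z, (CReLU τ m (Real.sqrt q * z)) ^ 2 ∂stdGaussian + σb ^ 2)
            - σb ^ 2) := by
  have h := integral_CST_sq hτ hm (Real.sqrt q)
  refine ⟨h, fun σw σb => ?_⟩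
  rw [h]
  ring
end
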